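/- Let k ≥ 3 be an integer, let x₁,…,x_k be distinct points of S², and let α̃₁,…,α̃_k be real numbers with α̃ⱼ > −1/2 for each j and β := −1 − ∑_{j=1}^{k} α̃ⱼ > 0. Let 𝒫' be the set of measurable functions ρ : S² → [0,∞) with ∫_{S²} ρ da = 1 and H(ρ) := ∫_{S²} ρ(x)·ln ρ(x) da(x) finite. For ρ ∈ 𝒫' define L(ρ) := ∑_{j=1}^{k} 4α̃ⱼ ∫_{S²} G(xⱼ,x)·ρ(x) da(x), R(ρ) := ∫_{S²}∫_{S²} ρ(x)ρ(y)·G(x,y) da(x) da(y), and S(ρ) := L(ρ) + 2β·R(ρ) + H(ρ). Then: (1) for every ρ ∈ 𝒫', L(ρ) and R(ρ) are finite; (2) there exists ρ̂ ∈ 𝒫' such that S(ρ̂) = inf_{ρ∈𝒫'} S(ρ); (3) this minimizer is unique up to equality a-almost everywhere, i.e., any two minimizers of S over 𝒫' agree a-almost everywhere on S². -/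

import Mathlib

open MeasureTheory Filter

noncomputable section

abbrev E3 := EuclideanSpace ℝ (Fin 3)

/-- The unit sphere `S² ⊆ ℝ³`. -/
def S2 : Set E3 := Metric.sphere 0 1

/-- The surface (area) measure on `S²`, realized as the 2-dimensional Hausdorff measure. -/
def areaMeasure : Measure S2 := μH[2]

/-- The Green's function `G(x,y) = −ln‖x−y‖ − 1/2 + ln 2` on the sphere. -/
def sphG (x y : S2) : ℝ := -Real.log ‖(x : E3) - (y : E3)‖ - 1/2 + Real.log 2

/-- Membership in `𝒫'`: `ρ` is a measurable probability density on `S²` with respect to the area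
measure, whose entropy integrand `ρ ln ρ` is integrable (i.e. `H(ρ)` is finite). -/
def memP' (ρ : S2 → ℝ) : Prop :=
  Measurable ρ ∧ (∀ z, 0 ≤ ρ z) ∧ (∫ z, ρ z ∂areaMeasure) = 1 ∧
    Integrable (fun z => ρ z * Real.log (ρ z)) areaMeasure

/-- The entropy functional `H(ρ) = ∫ ρ ln ρ da`. -/
def Hfun (ρ : S2 → ℝ) : ℝ := ∫ z, ρ z * Real.log (ρ z) ∂areaMeasure

/-- The linear functional `L(ρ) = ∑ⱼ 4α̃ⱼ ∫ G(xⱼ,x) ρ(x) da(x)`. -/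
def Lfun (k : ℕ) (αt : Fin k → ℝ) (x : Fin k → S2) (ρ : S2 → ℝ) : ℝ :=
  ∑ j, 4 * αt j * ∫ z, sphG (x j) z * ρ z ∂areaMeasure

/-- The quadratic functional `R(ρ) = ∫∫ ρ(x) ρ(y) G(x,y) da(x) da(y)`. -/
def Rfun (ρ : S2 → ℝ) : ℝ :=
  ∫ p : S2 × S2, ρ p.1 * ρ p.2 * sphG p.1 p.2 ∂(areaMeasure.prod areaMeasure)

/-- The functional `S(ρ) = L(ρ) + 2β R(ρ) + H(ρ)`. -/
def Sfun (k : ℕ) (αt : Fin k → ℝ) (x : Fin k → S2) (β : ℝ) (ρ : S2 → ℝ) : ℝ :=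
  Lfun k αt x ρ + 2 * β * Rfun ρ + Hfun ρ

/-! ### Geometry of the sphere and its Hausdorff measure -/

/-- The projection of the sphere to the coordinate plane obtained by dropping coordinate `i`. -/
def coordProj (i : Fin 3) (y : S2) : Fin 2 → ℝ := fun k => (y : E3) (i.succAbove k)

lemma sum_sq_eq_one (y : S2) : ∑ j, ((y : E3) j) ^ 2 = 1 := by
  have h : ‖(y : E3)‖ = 1 := by simpa [S2] using y.2
  rw [EuclideanSpace.norm_eq, Real.sqrt_eq_one] at h
  simpa using h

lemma lipschitzWith_coordProj (i : Fin 3) : LipschitzWith 1 (coordProj i) := by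
  refine LipschitzWith.of_dist_le_mul fun y z => ?_
  rw [NNReal.coe_one, one_mul, dist_pi_le_iff dist_nonneg]
  intro k
  rw [Subtype.dist_eq, dist_eq_norm, dist_eq_norm]
  exact PiLp.norm_apply_le ((y : E3) - (z : E3)) (i.succAbove k)

lemma dist_le_coordProj (i : Fin 3) {σ : ℝ} (hσ : σ ^ 2 = 1) {y z : S2}
    (hy : 1 / 2 ≤ σ * (y : E3) i) (hz : 1 / 2 ≤ σ * (z : E3) i) :
    dist y z ≤ 5 * dist (coordProj i y) (coordProj i z) := by
  set d := dist (coordProj i y) (coordProj i z) with hd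
  have hd0 : 0 ≤ d := dist_nonneg
  have hk : ∀ k, |(y : E3) (i.succAbove k) - (z : E3) (i.succAbove k)| ≤ d := fun k => by
    have := dist_le_pi_dist (coordProj i y) (coordProj i z) k
    rwa [Real.dist_eq] at this
  have hy1 := sum_sq_eq_one y
  have hz1 := sum_sq_eq_one z
  rw [Fin.sum_univ_succAbove _ i, Fin.sum_univ_two] at hy1 hz1
  have h0 := hk 0
  have h1 := hk 1
  rw [Subtype.dist_eq, EuclideanSpace.dist_eq, Fin.sum_univ_succAbove _ i, Fin.sum_univ_two,
    Real.sqrt_le_left (by positivity)]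
  simp only [Real.dist_eq, sq_abs]
  generalize (y : E3) i = a at *
  generalize (z : E3) i = a' at *
  generalize (y : E3) (i.succAbove 0) = b at *
  generalize (z : E3) (i.succAbove 0) = b' at *
  generalize (y : E3) (i.succAbove 1) = c at *
  generalize (z : E3) (i.succAbove 1) = c' at *
  have key : ∀ {p q : ℝ}, p ^ 2 ≤ 1 → q ^ 2 ≤ 1 → |p + q| ≤ 2 := fun {p q} hp hq => by
    rw [sq_le_one_iff_abs_le_one] at hp hq
    linarith [abs_add_le p q]
  have hb : |b + b'| ≤ 2 := key (by nlinarith) (by nlinarith)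
  have hc : |c + c'| ≤ 2 := key (by nlinarith) (by nlinarith)
  have hsum : 1 ≤ |a + a'| := by
    have h2 : |σ| = 1 := by
      rw [← sq_eq_sq₀ (abs_nonneg _) zero_le_one, sq_abs, hσ, one_pow]
    calc (1 : ℝ) ≤ |σ * (a + a')| := le_trans (by linarith) (le_abs_self _)
      _ = |a + a'| := by rw [abs_mul, h2, one_mul]
  have ha : |a - a'| ≤ 4 * d := by
    calc |a - a'| ≤ |a - a'| * |a + a'| := le_mul_of_one_le_right (abs_nonneg _) hsum
      _ = |(b - b') * (b + b') + (c - c') * (c + c')| := by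
        rw [← abs_mul, ← abs_neg]; congr 1; linarith
      _ ≤ |b - b'| * |b + b'| + |c - c'| * |c + c'| := by
        rw [← abs_mul, ← abs_mul]; exact abs_add_le _ _
      _ ≤ d * 2 + d * 2 := by gcongr
      _ = 4 * d := by ring
  have e1 := sq_le_sq' (by linarith [abs_nonneg (a - a')]) ha
  have e2 := sq_le_sq' (by linarith [abs_nonneg (b - b')]) h0
  have e3 := sq_le_sq' (by linarith [abs_nonneg (c - c')]) h1
  rw [sq_abs] at e1 e2 e3
  nlinarith

lemma areaMeasure_patch_le (i : Fin 3) {σ : ℝ} (hσ : σ ^ 2 = 1) (x : S2) {r : ℝ} (hr : 0 ≤ r) :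
    areaMeasure ({y : S2 | 1 / 2 ≤ σ * (y : E3) i} ∩ Metric.closedBall x r) ≤
      ENNReal.ofReal (100 * r ^ 2) := by
  set A : Set S2 := {y : S2 | 1 / 2 ≤ σ * (y : E3) i} ∩ Metric.closedBall x r
  have hanti : AntilipschitzWith 5 (fun y : A => coordProj i y) :=
    AntilipschitzWith.of_le_mul_dist fun y z => dist_le_coordProj i hσ y.2.1 z.2.1
  have h1 := hanti.le_hausdorffMeasure_image (d := 2) (by norm_num) Set.univ
  have h2 : areaMeasure A = μH[2] (Set.univ : Set A) := by
    rw [areaMeasure, ← (isometry_subtype_coe (s := A)).hausdorffMeasure_image (Or.inl (by norm_num)),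
      Set.image_univ, Subtype.range_coe]
  have h3 : (fun y : A => coordProj i y) '' Set.univ ⊆
      Metric.closedBall (coordProj i x) r := by
    rintro _ ⟨y, -, rfl⟩
    exact ((lipschitzWith_coordProj i).dist_le_mul _ _).trans (by simpa using y.2.2)
  have h4 : (μH[2] : Measure (Fin 2 → ℝ)) = volume := by
    simpa using hausdorffMeasure_pi_real (ι := Fin 2)
  rw [h2]
  refine h1.trans ((mul_le_mul_right (measure_mono h3) _).trans ?_)
  rw [h4, Real.volume_pi_closedBall _ hr, Fintype.card_fin]
  have h5 : (((5 : NNReal) : ENNReal) ^ (2 : ℝ)) = ENNReal.ofReal 25 := by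
    norm_num
  rw [h5, ← ENNReal.ofReal_mul (by norm_num)]
  exact ENNReal.ofReal_le_ofReal (by nlinarith)

lemma areaMeasure_closedBall_le (x : S2) {r : ℝ} (hr : 0 ≤ r) :
    areaMeasure (Metric.closedBall x r) ≤ ENNReal.ofReal (600 * r ^ 2) := by
  have hcov : Metric.closedBall x r ⊆ ⋃ i : Fin 3,
      (({y : S2 | 1 / 2 ≤ (1 : ℝ) * (y : E3) i} ∩ Metric.closedBall x r) ∪
        ({y : S2 | 1 / 2 ≤ (-1 : ℝ) * (y : E3) i} ∩ Metric.closedBall x r)) := by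
    intro y hy
    by_contra hcon
    simp only [Set.mem_iUnion, Set.mem_union, Set.mem_inter_iff, Set.mem_ofPred_eq, hy, and_true,
      not_exists, not_or, not_le] at hcon
    have h1 := sum_sq_eq_one y
    rw [Fin.sum_univ_three] at h1
    have h' := fun i : Fin 3 => sq_lt_sq' (by linarith [(hcon i).2] : -(1 / 2) < (y : E3) i)
      (by linarith [(hcon i).1])
    linarith [h' 0, h' 1, h' 2]
  refine (measure_mono hcov).trans ((measure_iUnion_fintype_le _ _).trans ?_)
  calc _ ≤ ∑ i : Fin 3, (ENNReal.ofReal (100 * r ^ 2) + ENNReal.ofReal (100 * r ^ 2)) :=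
        Finset.sum_le_sum fun i _ => (measure_union_le _ _).trans
          (add_le_add (areaMeasure_patch_le i (by norm_num) x hr)
            (areaMeasure_patch_le i (by norm_num) x hr))
    _ = _ := by
        rw [← ENNReal.ofReal_add (by positivity) (by positivity), Finset.sum_const,
          Finset.card_univ, Fintype.card_fin, ← ENNReal.ofReal_nsmul]
        congr 1
        simp only [nsmul_eq_mul]
        push_cast
        ring

lemma norm_sub_le_two (x y : S2) : ‖(x : E3) - (y : E3)‖ ≤ 2 := by
  have hx : ‖(x : E3)‖ = 1 := by simpa [S2] using x.2
  have hy : ‖(y : E3)‖ = 1 := by simpa [S2] using y.2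
  linarith [norm_sub_le (x : E3) y]

/-- The point of the upper hemisphere above a point of the open unit disc. -/
lemma exists_coordProj_eq {v : Fin 2 → ℝ} (hv : v 0 ^ 2 + v 1 ^ 2 ≤ 1) :
    ∃ y : S2, coordProj 2 y = v := by
  refine ⟨⟨!₂[v 0, v 1, √(1 - v 0 ^ 2 - v 1 ^ 2)], ?_⟩, ?_⟩
  · rw [S2, mem_sphere_zero_iff_norm, EuclideanSpace.norm_eq, Real.sqrt_eq_one,
      Fin.sum_univ_three]
    simp only [Real.norm_eq_abs, sq_abs, Matrix.cons_val]
    rw [Real.sq_sqrt (by linarith)]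
    ring
  · ext k
    fin_cases k <;> rfl

instance : IsFiniteMeasure areaMeasure := by
  obtain ⟨x, -⟩ := exists_coordProj_eq (v := 0) (by norm_num)
  refine ⟨(measure_mono fun y _ => ?_).trans_lt
    ((areaMeasure_closedBall_le x zero_le_two).trans_lt ENNReal.ofReal_lt_top)⟩
  rw [Metric.mem_closedBall, Subtype.dist_eq, dist_eq_norm]
  exact norm_sub_le_two y x

lemma areaMeasure_ne_zero : areaMeasure Set.univ ≠ 0 := by
  have h1 := (lipschitzWith_coordProj 2).hausdorffMeasure_image_le (d := 2) (by norm_num) Set.univ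
  have h4 : (μH[2] : Measure (Fin 2 → ℝ)) = volume := by
    simpa using hausdorffMeasure_pi_real (ι := Fin 2)
  have h3 : Metric.closedBall (0 : Fin 2 → ℝ) (1 / 2) ⊆ coordProj 2 '' Set.univ := by
    intro v hv
    rw [Metric.mem_closedBall, dist_pi_le_iff (by norm_num)] at hv
    have h' := fun k => sq_le_sq' (neg_le_of_abs_le (by simpa using hv k)) (le_of_abs_le
      (by simpa using hv k) : v k ≤ 1 / 2)
    obtain ⟨y, hy⟩ := exists_coordProj_eq (v := v) (by linarith [h' 0, h' 1])
    exact ⟨y, trivial, hy⟩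
  have h5 := measure_mono (μ := volume) h3
  rw [Real.volume_pi_closedBall _ (by norm_num), ← h4] at h5
  intro h0
  have h6 : (μH[2] : Measure S2) Set.univ = 0 := h0
  rw [h6, mul_zero] at h1
  have h7 := h5.trans h1
  norm_num at h7

instance : NeZero areaMeasure := ⟨fun h => areaMeasure_ne_zero (by rw [h]; rfl)⟩

instance : NullSingletonClass areaMeasure := by
  refine ⟨fun x => ?_⟩
  have h : areaMeasure {x} ≤ ENNReal.ofReal (600 * 0 ^ 2) := by
    simpa using areaMeasure_closedBall_le x le_rfl
  simpa using h

/-! ### Integrability of the singular kernels -/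

lemma areaMeasure_le_rpow_dist_le {s : ℝ} (hs : 0 < s) (x : S2) {t : ℝ} (ht : 0 < t) :
    areaMeasure {y | t ≤ dist x y ^ (-s)} ≤ ENNReal.ofReal (600 * t ^ (-(2 / s))) := by
  have h := areaMeasure_closedBall_le x (Real.rpow_nonneg ht.le (-(1 / s)))
  rw [← Real.rpow_mul_natCast ht.le] at h
  refine (measure_mono fun y (hy : t ≤ dist x y ^ (-s)) => ?_).trans (h.trans_eq ?_)
  · rw [Metric.mem_closedBall, dist_comm]
    rcases (dist_nonneg (x := x) (y := y)).eq_or_lt with h0 | h0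
    · rw [← h0]; positivity
    · calc dist x y = (dist x y ^ (-s)) ^ (-(1 / s)) := by
            rw [← Real.rpow_mul h0.le]; field_simp; simp
        _ ≤ _ := Real.rpow_le_rpow_of_nonpos ht hy (by rw [neg_nonpos]; positivity)
  · congr 3
    push_cast
    ring

lemma measurable_dist_rpow (s : ℝ) (x : S2) : Measurable fun y : S2 => dist x y ^ (-s) :=
  (Continuous.measurable (by fun_prop : Continuous fun y : S2 => dist x y)).pow_const _

/-- Riesz kernels of exponent below the dimension are integrable, uniformly in the pole. -/
lemma exists_lintegral_dist_rpow_le {s : ℝ} (hs : 0 < s) (hs2 : s < 2) :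
    ∃ C : NNReal, ∀ x : S2, ∫⁻ y, ENNReal.ofReal (dist x y ^ (-s)) ∂areaMeasure ≤ C := by
  have hint : IntegrableOn (fun t : ℝ => 600 * t ^ (-(2 / s))) (Set.Ioi 1) :=
    (integrableOn_Ioi_rpow_of_lt (by rw [neg_lt_neg_iff, one_lt_div hs]; exact hs2)
      zero_lt_one).const_mul _
  have hfin : areaMeasure Set.univ * 1 +
      ∫⁻ t in Set.Ioi (1 : ℝ), ENNReal.ofReal (600 * t ^ (-(2 / s))) ≠ ⊤ :=
    ENNReal.add_ne_top.2 ⟨by simp, hint.lintegral_lt_top.ne⟩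
  refine ⟨_, fun x => le_trans ?_ (ENNReal.coe_toNNReal hfin).ge⟩
  rw [lintegral_eq_lintegral_meas_le _ (Eventually.of_forall fun y => by positivity)
    (measurable_dist_rpow s x).aemeasurable, ← Set.Ioc_union_Ioi_eq_Ioi zero_le_one,
    lintegral_union measurableSet_Ioi Set.Ioc_disjoint_Ioi_same]
  refine add_le_add ?_ ?_
  · calc _ ≤ ∫⁻ _ in Set.Ioc (0 : ℝ) 1, areaMeasure Set.univ :=
          lintegral_mono fun t => measure_mono (Set.subset_univ _)
      _ = _ := by simp
  · exact setLIntegral_mono' measurableSet_Ioi fun t ht =>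
      areaMeasure_le_rpow_dist_le hs x (zero_lt_one.trans ht)

lemma integrable_dist_rpow {s : ℝ} (hs : 0 < s) (hs2 : s < 2) (x : S2) :
    Integrable (fun y => dist x y ^ (-s)) areaMeasure := by
  obtain ⟨C, hC⟩ := exists_lintegral_dist_rpow_le hs hs2
  refine ⟨(measurable_dist_rpow s x).aestronglyMeasurable, ?_⟩
  rw [hasFiniteIntegral_iff_ofReal (Eventually.of_forall fun y => by positivity)]
  exact (hC x).trans_lt ENNReal.coe_lt_top

lemma exists_integral_dist_rpow_le {s : ℝ} (hs : 0 < s) (hs2 : s < 2) :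
    ∃ C : ℝ, ∀ x : S2, ∫ y, dist x y ^ (-s) ∂areaMeasure ≤ C := by
  obtain ⟨C, hC⟩ := exists_lintegral_dist_rpow_le hs hs2
  refine ⟨C, fun x => ?_⟩
  rw [integral_eq_lintegral_of_nonneg_ae (Eventually.of_forall fun y => by positivity)
    (measurable_dist_rpow s x).aestronglyMeasurable]
  exact ENNReal.toReal_le_of_le_ofReal C.2 (by simpa using hC x)

/-- The Fenchel–Young inequality for the entropy. -/
lemma mul_log_le {r w : ℝ} (hr : 0 ≤ r) (hw : 0 < w) :
    r * Real.log w ≤ r * Real.log r - r + w := by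
  rcases hr.eq_or_lt with rfl | hr
  · simp [hw.le]
  · have h := Real.log_le_sub_one_of_pos (div_pos hw hr)
    rw [Real.log_div hw.ne' hr.ne'] at h
    have h' := mul_le_mul_of_nonneg_left h hr.le
    rw [mul_sub, mul_sub, mul_div_cancel₀ _ hr.ne'] at h'
    linarith

lemma sub_one_le_mul_log {r : ℝ} (hr : 0 ≤ r) : r - 1 ≤ r * Real.log r := by
  have := mul_log_le hr one_pos
  rw [Real.log_one, mul_zero] at this
  linarith

lemma sphG_eq {x y : S2} (h : x ≠ y) : sphG x y = Real.log (2 * (dist x y)⁻¹) - 1 / 2 := by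
  have hd : 0 < dist x y := dist_pos.2 h
  rw [Real.log_mul two_ne_zero (inv_ne_zero hd.ne'), Real.log_inv, sphG, Subtype.dist_eq,
    dist_eq_norm]
  ring

lemma sphG_self (x : S2) : sphG x x = -(1 / 2) + Real.log 2 := by
  simp [sphG]

lemma log_two_mul_inv_dist_nonneg {x y : S2} (h : x ≠ y) :
    0 ≤ Real.log (2 * (dist x y)⁻¹) := by
  have hd : 0 < dist x y := dist_pos.2 h
  refine Real.log_nonneg ?_
  rw [← div_eq_mul_inv, one_le_div hd, Subtype.dist_eq, dist_eq_norm]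
  exact norm_sub_le_two x y

lemma neg_half_le_sphG (x y : S2) : -(1 / 2) ≤ sphG x y := by
  rcases eq_or_ne x y with rfl | h
  · rw [sphG_self]; linarith [Real.log_nonneg one_le_two]
  · rw [sphG_eq h]; linarith [log_two_mul_inv_dist_nonneg h]

lemma measurable_sphG : Measurable fun p : S2 × S2 => sphG p.1 p.2 := by
  have h : Measurable fun p : S2 × S2 => (p.1 : E3) - (p.2 : E3) :=
    Continuous.measurable (by fun_prop)
  exact ((Real.measurable_log.comp h.norm).neg.sub_const _).add_const _

lemma measurable_sphG_right (x : S2) : Measurable (sphG x) :=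
  Measurable.of_uncurry_left (f := sphG) measurable_sphG

lemma mul_abs_sphG_le (x y : S2) {r : ℝ} (hr : 0 ≤ r) :
    r * |sphG x y| ≤ r * Real.log r + r + 1 + 2 * dist x y ^ (-1 : ℝ) := by
  have h1 := sub_one_le_mul_log hr
  rcases eq_or_ne x y with rfl | h
  · have h2 : |sphG x x| ≤ 1 := by
      rw [sphG_self, abs_le]
      constructor <;> linarith [Real.log_two_gt_d9, Real.log_two_lt_d9]
    have h3 : (0 : ℝ) ≤ dist x x ^ (-1 : ℝ) := by positivity
    nlinarith
  · have hd : 0 < dist x y := dist_pos.2 h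
    have h2 : |sphG x y| ≤ Real.log (2 * (dist x y)⁻¹) + 1 / 2 := by
      have := log_two_mul_inv_dist_nonneg h
      rw [sphG_eq h, abs_le]
      constructor <;> linarith
    have h3 := mul_log_le hr (by positivity : 0 < 2 * (dist x y)⁻¹)
    rw [Real.rpow_neg_one]
    nlinarith [mul_le_mul_of_nonneg_left h2 hr]

namespace memP'

variable {ρ ρ₁ ρ₂ : S2 → ℝ}

lemma integrable (h : memP' ρ) : Integrable ρ areaMeasure := by
  by_contra hcon
  have := h.2.2.1
  rw [integral_undef hcon] at this
  exact zero_ne_one this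

lemma integrable_entropy_bound (h : memP' ρ) :
    Integrable (fun y => ρ y * Real.log (ρ y) + ρ y + 1) areaMeasure :=
  (h.2.2.2.add h.integrable).add (integrable_const 1)

lemma integrable_sphG_mul (h : memP' ρ) (x : S2) :
    Integrable (fun z => sphG x z * ρ z) areaMeasure := by
  refine (h.integrable_entropy_bound.add
    ((integrable_dist_rpow one_pos one_lt_two x).const_mul 2)).mono'
    ((measurable_sphG_right x).mul h.1).aestronglyMeasurable (Eventually.of_forall fun y => ?_)
  rw [Real.norm_eq_abs, abs_mul, abs_of_nonneg (h.2.1 y), mul_comm]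
  exact mul_abs_sphG_le x y (h.2.1 y)

lemma integrable_mul_dist_inv (h : memP' ρ) :
    Integrable (fun p : S2 × S2 => ρ p.1 * dist p.1 p.2 ^ (-1 : ℝ))
      (areaMeasure.prod areaMeasure) := by
  obtain ⟨C, hC⟩ := exists_integral_dist_rpow_le (zero_lt_one' ℝ) one_lt_two
  have hd : Measurable fun p : S2 × S2 => dist p.1 p.2 := continuous_dist.measurable
  have hm : Measurable fun p : S2 × S2 => ρ p.1 * dist p.1 p.2 ^ (-1 : ℝ) :=
    (h.1.comp measurable_fst).mul (hd.pow_const _)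
  have hi : ∀ x, Integrable (fun y => ρ x * dist x y ^ (-1 : ℝ)) areaMeasure := fun x =>
    (integrable_dist_rpow (zero_lt_one' ℝ) one_lt_two x).const_mul (ρ x)
  refine (integrable_prod_iff hm.aestronglyMeasurable).2 ⟨Eventually.of_forall hi, ?_⟩
  refine (h.integrable.mul_const C).mono'
    (hm.norm.stronglyMeasurable.integral_prod_right).aestronglyMeasurable
    (Eventually.of_forall fun x => ?_)
  rw [Real.norm_of_nonneg (integral_nonneg fun _ => norm_nonneg _)]
  calc _ = ∫ y, ρ x * dist x y ^ (-1 : ℝ) ∂areaMeasure := by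
        congr with y
        exact Real.norm_of_nonneg (mul_nonneg (h.2.1 x) (by positivity))
    _ ≤ _ := by
        rw [integral_const_mul]
        exact mul_le_mul_of_nonneg_left (hC x) (h.2.1 x)

lemma integrable_mul_mul_sphG (h : memP' ρ) :
    Integrable (fun p : S2 × S2 => ρ p.1 * ρ p.2 * sphG p.1 p.2)
      (areaMeasure.prod areaMeasure) := by
  refine ((h.integrable.mul_prod h.integrable_entropy_bound).add
    (h.integrable_mul_dist_inv.const_mul 2)).mono'
    (((h.1.comp measurable_fst).mul (h.1.comp measurable_snd)).mul
      measurable_sphG).aestronglyMeasurable (Eventually.of_forall fun p => ?_)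
  rw [Real.norm_eq_abs, abs_mul, abs_mul, abs_of_nonneg (h.2.1 _), abs_of_nonneg (h.2.1 _)]
  have := mul_le_mul_of_nonneg_left (mul_abs_sphG_le p.1 p.2 (h.2.1 p.2)) (h.2.1 p.1)
  simp only [Pi.add_apply]
  linarith

end memP'

/-! ### Conditional positive definiteness of the logarithmic kernel -/

lemma ae_fst_ne_snd : ∀ᵐ p : S2 × S2 ∂(areaMeasure.prod areaMeasure), p.1 ≠ p.2 := by
  have hm : MeasurableSet {p : S2 × S2 | p.1 = p.2} :=
    measurableSet_eq_fun measurable_fst measurable_snd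
  have h : (areaMeasure.prod areaMeasure) {p : S2 × S2 | p.1 = p.2} = 0 := by
    rw [Measure.measure_prod_null hm]
    refine Eventually.of_forall fun x => ?_
    have : Prod.mk x ⁻¹' {p : S2 × S2 | p.1 = p.2} = {x} := by
      ext y
      simp [eq_comm]
    simp [this]
  simpa [ae_iff] using h

/-- The inner product kernel on the sphere. -/
def innerKernel (p : S2 × S2) : ℝ := inner ℝ (p.1 : E3) (p.2 : E3)

lemma continuous_innerKernel : Continuous innerKernel :=
  (continuous_subtype_val.comp continuous_fst).inner (continuous_subtype_val.comp continuous_snd)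

lemma norm_coe_eq_one (x : S2) : ‖(x : E3)‖ = 1 := by
  simpa [S2] using x.2

lemma abs_innerKernel_le_one (p : S2 × S2) : |innerKernel p| ≤ 1 := by
  have := abs_real_inner_le_norm (p.1 : E3) (p.2 : E3)
  rwa [norm_coe_eq_one, norm_coe_eq_one, one_mul] at this

lemma norm_sub_sq_eq_innerKernel (p : S2 × S2) :
    ‖(p.1 : E3) - (p.2 : E3)‖ ^ 2 = 2 * (1 - innerKernel p) := by
  rw [norm_sub_sq_real, norm_coe_eq_one, norm_coe_eq_one, innerKernel]
  ring

lemma innerKernel_lt_one {p : S2 × S2} (h : p.1 ≠ p.2) : innerKernel p < 1 := by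
  have h1 : 0 < ‖(p.1 : E3) - (p.2 : E3)‖ :=
    norm_pos_iff.2 (sub_ne_zero.2 fun h2 => h (Subtype.ext h2))
  nlinarith [norm_sub_sq_eq_innerKernel p, pow_pos h1 2]

lemma sphG_eq_log_innerKernel {p : S2 × S2} (h : p.1 ≠ p.2) :
    sphG p.1 p.2 = 1 / 2 * -Real.log (1 - innerKernel p) + (Real.log 2 - 1) / 2 := by
  have h1 : Real.log (‖(p.1 : E3) - (p.2 : E3)‖ ^ 2) =
      Real.log 2 + Real.log (1 - innerKernel p) := by
    rw [norm_sub_sq_eq_innerKernel,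
      Real.log_mul two_ne_zero (sub_pos.2 (innerKernel_lt_one h)).ne']
  rw [Real.log_pow] at h1
  push_cast at h1
  rw [sphG]
  linarith

section LogEnergy

variable {f : S2 → ℝ}

lemma integral_mul_mul_innerKernel_pow_nonneg (hf : Integrable f areaMeasure) (n : ℕ) :
    0 ≤ ∫ p : S2 × S2, f p.1 * f p.2 * innerKernel p ^ n ∂(areaMeasure.prod areaMeasure) := by
  let m : (Fin n → Fin 3) → S2 → ℝ := fun g x => ∏ k, (x : E3) (g k)
  have hm : ∀ g, Continuous (m g) := fun g => by
    refine continuous_finsetProd _ fun k _ => ?_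
    exact (EuclideanSpace.proj (𝕜 := ℝ) (g k)).continuous.comp continuous_subtype_val
  have hm1 : ∀ g x, ‖m g x‖ ≤ 1 := fun g x => by
    rw [norm_prod]
    refine Finset.prod_le_one (fun _ _ => norm_nonneg _) fun k _ => ?_
    exact (PiLp.norm_apply_le (x : E3) (g k)).trans (norm_coe_eq_one x).le
  have hint : ∀ g, Integrable (fun x => f x * m g x) areaMeasure := fun g =>
    hf.mul_bdd (hm g).aestronglyMeasurable (Eventually.of_forall (hm1 g))
  have hexp : ∀ p : S2 × S2, f p.1 * f p.2 * innerKernel p ^ n =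
      ∑ g, (f p.1 * m g p.1) * (f p.2 * m g p.2) := fun p => by
    have h1 : innerKernel p = ∑ i, (p.1 : E3) i * (p.2 : E3) i := by
      simp only [innerKernel, PiLp.inner_apply, RCLike.inner_apply, conj_trivial]
      exact Finset.sum_congr rfl fun i _ => mul_comm _ _
    rw [h1, Fintype.sum_pow, Finset.mul_sum]
    refine Finset.sum_congr rfl fun g _ => ?_
    rw [Finset.prod_mul_distrib]
    ring
  simp_rw [hexp]
  rw [integral_finsetSum _ fun g _ => (hint g).mul_prod (hint g)]
  refine Finset.sum_nonneg fun g _ => ?_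
  rw [integral_prod_mul (fun x => f x * m g x) (fun x => f x * m g x)]
  exact mul_self_nonneg _

lemma integral_mul_mul_log_one_sub_nonneg (hf : Integrable f areaMeasure) {t : ℝ} (ht0 : 0 ≤ t)
    (ht1 : t < 1) :
    0 ≤ ∫ p : S2 × S2, f p.1 * f p.2 * -Real.log (1 - t * innerKernel p)
      ∂(areaMeasure.prod areaMeasure) := by
  have hff : Integrable (fun p : S2 × S2 => f p.1 * f p.2) (areaMeasure.prod areaMeasure) :=
    hf.mul_prod hf
  have habs : ∀ p, |t * innerKernel p| ≤ t := fun p => by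
    rw [abs_mul, abs_of_nonneg ht0]
    exact mul_le_of_le_one_right ht0 (abs_innerKernel_le_one p)
  have hsum := hasSum_integral_of_dominated_convergence
    (μ := areaMeasure.prod areaMeasure)
    (F := fun (n : ℕ) (p : S2 × S2) =>
      f p.1 * f p.2 * ((t * innerKernel p) ^ (n + 1) / ((n : ℝ) + 1)))
    (f := fun p => f p.1 * f p.2 * -Real.log (1 - t * innerKernel p))
    (fun n p => ‖f p.1 * f p.2‖ * t ^ n) ?_ ?_ ?_ ?_ ?_
  · refine hsum.nonneg fun n => ?_
    have : ∀ p : S2 × S2, f p.1 * f p.2 * ((t * innerKernel p) ^ (n + 1) / ((n : ℝ) + 1)) =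
        t ^ (n + 1) / ((n : ℝ) + 1) * (f p.1 * f p.2 * innerKernel p ^ (n + 1)) := fun p => by
      rw [mul_pow]; ring
    simp_rw [this]
    rw [integral_const_mul]
    exact mul_nonneg (by positivity) (integral_mul_mul_innerKernel_pow_nonneg hf _)
  · intro n
    refine hff.aestronglyMeasurable.mul (Continuous.aestronglyMeasurable ?_)
    exact ((continuous_const.mul continuous_innerKernel).pow _).div_const _
  · refine fun n => Eventually.of_forall fun p => ?_
    rw [norm_mul]
    refine mul_le_mul_of_nonneg_left ?_ (norm_nonneg _)
    rw [norm_div, norm_pow, Real.norm_eq_abs, Real.norm_of_nonneg (by positivity : 0 ≤ (n : ℝ) + 1)]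
    calc |t * innerKernel p| ^ (n + 1) / ((n : ℝ) + 1) ≤ t ^ (n + 1) / 1 := by
          gcongr
          · exact habs p
          · linarith [(Nat.cast_nonneg n : (0 : ℝ) ≤ n)]
      _ ≤ t ^ n := by
          rw [div_one]
          exact pow_le_pow_of_le_one ht0 ht1.le (Nat.le_succ n)
  · exact Eventually.of_forall fun p => (summable_geometric_of_lt_one ht0 ht1).mul_left _
  · simp_rw [tsum_mul_left]
    exact hff.norm.mul_const _
  · exact Eventually.of_forall fun p =>
      (Real.hasSum_pow_div_log_of_abs_lt_one ((habs p).trans_lt ht1)).mul_left _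

lemma abs_log_one_sub_mul_le {u t : ℝ} (hu : u < 1) (ht0 : 0 ≤ t) (ht1 : t ≤ 1) :
    |Real.log (1 - t * u)| ≤ |Real.log (1 - u)| := by
  rcases le_total 0 u with h | h
  · have h1 : 0 ≤ t * u := mul_nonneg ht0 h
    have h2 : t * u ≤ u := mul_le_of_le_one_left h ht1
    rw [abs_of_nonpos (Real.log_nonpos (by linarith) (by linarith)),
      abs_of_nonpos (Real.log_nonpos (by linarith) (by linarith)), neg_le_neg_iff]
    exact Real.log_le_log (by linarith) (by linarith)
  · have h1 : t * u ≤ 0 := mul_nonpos_of_nonneg_of_nonpos ht0 h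
    have h2 : u ≤ t * u := by nlinarith
    rw [abs_of_nonneg (Real.log_nonneg (by linarith)),
      abs_of_nonneg (Real.log_nonneg (by linarith))]
    exact Real.log_le_log (by linarith) (by linarith)

/-- The logarithmic energy is nonnegative on neutral charge distributions. -/
lemma integral_mul_mul_sphG_nonneg (hf : Integrable f areaMeasure)
    (hf0 : ∫ x, f x ∂areaMeasure = 0)
    (hfG : Integrable (fun p : S2 × S2 => f p.1 * f p.2 * sphG p.1 p.2)
      (areaMeasure.prod areaMeasure)) :
    0 ≤ ∫ p : S2 × S2, f p.1 * f p.2 * sphG p.1 p.2 ∂(areaMeasure.prod areaMeasure) := by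
  have hff : Integrable (fun p : S2 × S2 => f p.1 * f p.2) (areaMeasure.prod areaMeasure) :=
    hf.mul_prod hf
  set c : ℝ := (Real.log 2 - 1) / 2
  have hlog : Integrable (fun p : S2 × S2 => f p.1 * f p.2 * -Real.log (1 - innerKernel p))
      (areaMeasure.prod areaMeasure) := by
    refine ((hfG.sub (hff.mul_const c)).const_mul 2).congr ?_
    filter_upwards [ae_fst_ne_snd] with p hp
    simp only [Pi.sub_apply, sphG_eq_log_innerKernel hp, c]
    ring
  have heq : ∫ p : S2 × S2, f p.1 * f p.2 * sphG p.1 p.2 ∂(areaMeasure.prod areaMeasure) =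
      1 / 2 * ∫ p : S2 × S2, f p.1 * f p.2 * -Real.log (1 - innerKernel p)
        ∂(areaMeasure.prod areaMeasure) := by
    have h1 : ∫ p : S2 × S2, c * (f p.1 * f p.2) ∂(areaMeasure.prod areaMeasure) = 0 := by
      rw [integral_const_mul, integral_prod_mul f f, hf0, mul_zero, mul_zero]
    rw [← integral_const_mul, ← add_zero (∫ p : S2 × S2, 1 / 2 * _ ∂_), ← h1,
      ← integral_add (hlog.const_mul _) (hff.const_mul _)]
    refine integral_congr_ae ?_
    filter_upwards [ae_fst_ne_snd] with p hp
    rw [sphG_eq_log_innerKernel hp]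
    ring
  rw [heq]
  refine mul_nonneg (by norm_num) ?_
  have hev : ∀ᶠ t : ℝ in nhdsWithin 1 (Set.Iio 1), t ∈ Set.Ioo (0 : ℝ) 1 :=
    Ioo_mem_nhdsLT zero_lt_one
  refine ge_of_tendsto (tendsto_integral_filter_of_dominated_convergence
    (F := fun (t : ℝ) (p : S2 × S2) => f p.1 * f p.2 * -Real.log (1 - t * innerKernel p))
    (l := nhdsWithin 1 (Set.Iio 1)) _ ?_ ?_ hlog.norm ?_)
    (hev.mono fun t ht => integral_mul_mul_log_one_sub_nonneg hf ht.1.le ht.2)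
  · refine Eventually.of_forall fun t => hff.aestronglyMeasurable.mul ?_
    exact (Real.measurable_log.comp (measurable_const.sub
      (measurable_const.mul continuous_innerKernel.measurable))).neg.aestronglyMeasurable
  · refine hev.mono fun t ht => ?_
    filter_upwards [ae_fst_ne_snd] with p hp
    rw [norm_mul, norm_mul _ (-Real.log (1 - innerKernel p)), norm_neg, norm_neg]
    exact mul_le_mul_of_nonneg_left
      (abs_log_one_sub_mul_le (innerKernel_lt_one hp) ht.1.le ht.2.le) (norm_nonneg _)
  · filter_upwards [ae_fst_ne_snd] with p hp
    have h1 : ContinuousAt (fun t : ℝ => f p.1 * f p.2 * -Real.log (1 - t * innerKernel p)) 1 := by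
      refine continuousAt_const.mul (ContinuousAt.neg (ContinuousAt.log (by fun_prop) ?_))
      rw [one_mul]
      exact (sub_pos.2 (innerKernel_lt_one hp)).ne'
    have h2 := h1.tendsto
    rw [one_mul] at h2
    exact h2.mono_left nhdsWithin_le_nhds

end LogEnergy

/-! ### Uniform convexity of the entropy -/

lemma sq_sqrt_sub_sqrt_le {a m : ℝ} (ha : 0 ≤ a) (hm : 0 < m) :
    (√a - √m) ^ 2 ≤ a * Real.log a - a * Real.log m - a + m := by
  rcases ha.eq_or_lt with rfl | ha
  · simp [Real.sq_sqrt hm.le]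
  · have hsa := Real.sqrt_pos.2 ha
    have h := Real.log_le_sub_one_of_pos (div_pos (Real.sqrt_pos.2 hm) hsa)
    rw [Real.log_div (Real.sqrt_pos.2 hm).ne' hsa.ne', Real.log_sqrt hm.le,
      Real.log_sqrt ha.le] at h
    have h' := mul_le_mul_of_nonneg_left h ha.le
    have h2 : a * (√m / √a - 1) = √a * √m - a := by
      rw [mul_sub, mul_one, mul_div_assoc', mul_comm a, mul_div_assoc, Real.div_sqrt, mul_comm]
    rw [h2] at h'
    nlinarith [Real.sq_sqrt hm.le, Real.sq_sqrt ha.le]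

lemma mul_abs_sub_le_entropy {a m : ℝ} (ha : 0 ≤ a) (hm : 0 < m) (c : ℝ) :
    2 * c * |a - m| ≤ a * Real.log a - a * Real.log m - a + m + 2 * c ^ 2 * (a + m) := by
  have h1 := sq_sqrt_sub_sqrt_le ha hm
  have h2 : |a - m| = |√a - √m| * (√a + √m) := by
    rw [← abs_of_nonneg (by positivity : 0 ≤ √a + √m), ← abs_mul]
    congr 1
    nlinarith [Real.sq_sqrt hm.le, Real.sq_sqrt ha]
  have h3 : |√a - √m| ^ 2 = (√a - √m) ^ 2 := sq_abs _
  have h4 : (√a + √m) ^ 2 ≤ 2 * (a + m) := by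
    nlinarith [Real.sq_sqrt hm.le, Real.sq_sqrt ha, sq_nonneg (√a - √m)]
  rw [h2]
  nlinarith [sq_nonneg (|√a - √m| - c * (√a + √m)),
    mul_le_mul_of_nonneg_left h4 (sq_nonneg c)]

lemma mul_abs_sub_le_entropy_gap {a b c : ℝ} (ha : 0 ≤ a) (hb : 0 ≤ b) (hc : 0 ≤ c) :
    c * |a - b| ≤ (a * Real.log a + b * Real.log b) / 2 -
      (a + b) / 2 * Real.log ((a + b) / 2) + 2 * c ^ 2 * (a + b) := by
  rcases (by positivity : 0 ≤ (a + b) / 2).eq_or_lt with h0 | hm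
  · obtain rfl : a = 0 := by linarith
    obtain rfl : b = 0 := by linarith
    simp
  · have h1 := mul_abs_sub_le_entropy ha hm c
    have h2 := mul_abs_sub_le_entropy hb hm c
    have h3 : |a - b| ≤ |a - (a + b) / 2| + |b - (a + b) / 2| := by
      rw [abs_sub_comm b]
      exact abs_sub_le _ _ _
    have h4 := mul_le_mul_of_nonneg_left h3 hc
    linarith

lemma half_add_mul_log_le {a b : ℝ} (ha : 0 ≤ a) (hb : 0 ≤ b) :
    (a + b) / 2 * Real.log ((a + b) / 2) ≤ (a * Real.log a + b * Real.log b) / 2 := by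
  have := mul_abs_sub_le_entropy_gap ha hb le_rfl
  linarith

namespace memP'

variable {ρ₁ ρ₂ : S2 → ℝ}

lemma midpoint (h₁ : memP' ρ₁) (h₂ : memP' ρ₂) : memP' fun z => (ρ₁ z + ρ₂ z) / 2 := by
  have hnn : ∀ z, 0 ≤ (ρ₁ z + ρ₂ z) / 2 := fun z => by linarith [h₁.2.1 z, h₂.2.1 z]
  have hm : Measurable fun z => (ρ₁ z + ρ₂ z) / 2 := (h₁.1.add h₂.1).div_const 2
  refine ⟨hm, hnn, ?_, ?_⟩
  · rw [integral_div, integral_add h₁.integrable h₂.integrable, h₁.2.2.1, h₂.2.2.1]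
    norm_num
  · refine (((h₁.2.2.2.add h₂.2.2.2).div_const 2).abs.add (integrable_const 1)).mono'
      (hm.mul (Real.measurable_log.comp hm)).aestronglyMeasurable (Eventually.of_forall fun z => ?_)
    have e1 := half_add_mul_log_le (h₁.2.1 z) (h₂.2.1 z)
    have e2 := sub_one_le_mul_log (hnn z)
    have e3 := hnn z
    simp only [Pi.add_apply, Real.norm_eq_abs]
    rw [abs_le]
    constructor
    · linarith [abs_nonneg ((ρ₁ z * Real.log (ρ₁ z) + ρ₂ z * Real.log (ρ₂ z)) / 2)]
    · linarith [le_abs_self ((ρ₁ z * Real.log (ρ₁ z) + ρ₂ z * Real.log (ρ₂ z)) / 2)]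

lemma mul_integral_abs_sub_le_Hfun (h₁ : memP' ρ₁) (h₂ : memP' ρ₂) {c : ℝ} (hc : 0 ≤ c) :
    c * ∫ z, |ρ₁ z - ρ₂ z| ∂areaMeasure ≤
      (Hfun ρ₁ + Hfun ρ₂) / 2 - Hfun (fun z => (ρ₁ z + ρ₂ z) / 2) + 4 * c ^ 2 := by
  have hH := (h₁.2.2.2.add h₂.2.2.2).div_const 2
  have hM := (h₁.midpoint h₂).2.2.2
  have hs := (h₁.integrable.add h₂.integrable).const_mul (2 * c ^ 2)
  have h := integral_mono ((h₁.integrable.sub h₂.integrable).abs.const_mul c)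
    ((hH.sub hM).add hs) fun z => mul_abs_sub_le_entropy_gap (h₁.2.1 z) (h₂.2.1 z) hc
  rw [integral_const_mul, integral_add' (hH.sub hM) hs, integral_sub' hH hM, integral_div,
    integral_add' h₁.2.2.2 h₂.2.2.2, integral_const_mul,
    integral_add' h₁.integrable h₂.integrable, h₁.2.2.1, h₂.2.2.1] at h
  simp only [Hfun]
  calc _ ≤ _ := h
    _ = _ := by ring

lemma Lfun_midpoint (h₁ : memP' ρ₁) (h₂ : memP' ρ₂) {k : ℕ} (αt : Fin k → ℝ) (x : Fin k → S2) :
    Lfun k αt x (fun z => (ρ₁ z + ρ₂ z) / 2) = (Lfun k αt x ρ₁ + Lfun k αt x ρ₂) / 2 := by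
  simp only [Lfun, ← Finset.sum_add_distrib, Finset.sum_div]
  refine Finset.sum_congr rfl fun j _ => ?_
  have : ∀ z, sphG (x j) z * ((ρ₁ z + ρ₂ z) / 2) =
      (sphG (x j) z * ρ₁ z + sphG (x j) z * ρ₂ z) / 2 := fun z => by ring
  simp_rw [this]
  rw [integral_div, integral_add (h₁.integrable_sphG_mul _) (h₂.integrable_sphG_mul _)]
  ring

lemma Rfun_midpoint_le (h₁ : memP' ρ₁) (h₂ : memP' ρ₂) :
    Rfun (fun z => (ρ₁ z + ρ₂ z) / 2) ≤ (Rfun ρ₁ + Rfun ρ₂) / 2 := by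
  have i₁ := h₁.integrable_mul_mul_sphG
  have i₂ := h₂.integrable_mul_mul_sphG
  have iM := (h₁.midpoint h₂).integrable_mul_mul_sphG
  have heq : (fun p : S2 × S2 => (ρ₁ p.1 - ρ₂ p.1) * (ρ₁ p.2 - ρ₂ p.2) * sphG p.1 p.2) =
      fun p => 2 * (ρ₁ p.1 * ρ₁ p.2 * sphG p.1 p.2 + ρ₂ p.1 * ρ₂ p.2 * sphG p.1 p.2) -
        4 * ((ρ₁ p.1 + ρ₂ p.1) / 2 * ((ρ₁ p.2 + ρ₂ p.2) / 2) * sphG p.1 p.2) := by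
    funext p
    ring
  have hS : Integrable (fun p : S2 × S2 => 2 * (ρ₁ p.1 * ρ₁ p.2 * sphG p.1 p.2 +
      ρ₂ p.1 * ρ₂ p.2 * sphG p.1 p.2)) (areaMeasure.prod areaMeasure) :=
    (i₁.add i₂).const_mul 2
  have hint : Integrable (fun p : S2 × S2 => (ρ₁ p.1 - ρ₂ p.1) * (ρ₁ p.2 - ρ₂ p.2) *
      sphG p.1 p.2) (areaMeasure.prod areaMeasure) := by
    rw [heq]
    exact hS.sub (iM.const_mul 4)
  have h := integral_mul_mul_sphG_nonneg (f := fun z => ρ₁ z - ρ₂ z)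
    (h₁.integrable.sub h₂.integrable)
    (by rw [integral_sub h₁.integrable h₂.integrable, h₁.2.2.1, h₂.2.2.1, sub_self]) hint
  rw [heq, integral_sub hS (iM.const_mul 4), integral_const_mul,
    integral_const_mul, integral_add i₁ i₂] at h
  simp only [Rfun]
  linarith

/-- The functional `S` is uniformly convex for the `L¹` distance. -/
lemma mul_integral_abs_sub_le_Sfun (h₁ : memP' ρ₁) (h₂ : memP' ρ₂) {k : ℕ} (αt : Fin k → ℝ)
    (x : Fin k → S2) {β : ℝ} (hβ : 0 ≤ β) {c : ℝ} (hc : 0 ≤ c) :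
    c * ∫ z, |ρ₁ z - ρ₂ z| ∂areaMeasure ≤
      (Sfun k αt x β ρ₁ + Sfun k αt x β ρ₂) / 2 -
        Sfun k αt x β (fun z => (ρ₁ z + ρ₂ z) / 2) + 4 * c ^ 2 := by
  have hH := h₁.mul_integral_abs_sub_le_Hfun h₂ hc
  have hR := mul_le_mul_of_nonneg_left (h₁.Rfun_midpoint_le h₂) hβ
  simp only [Sfun, h₁.Lfun_midpoint h₂]
  linarith

end memP'

/-! ### Coercivity -/

/-- The external potential of the functional `L`. -/
def potential {k : ℕ} (αt : Fin k → ℝ) (x : Fin k → S2) (z : S2) : ℝ :=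
  ∑ j, 4 * αt j * sphG (x j) z

lemma neg_potential_le {k : ℕ} (hk : 0 < k) {x : Fin k → S2} (hx : Function.Injective x)
    (αt : Fin k → ℝ) {s : ℝ} (hs : ∀ j, -(4 * αt j) ≤ s) :
    ∃ C : ℝ, ∀ z, z ∉ Set.range x →
      ∃ i, -potential αt x z ≤ C + s * Real.log (2 * (dist (x i) z)⁻¹) := by
  have : Nonempty (Fin k) := ⟨⟨0, hk⟩⟩
  set Λ : Fin k → Fin k → ℝ := fun i j => 4 * |αt j| * |Real.log (4 * (dist (x i) (x j))⁻¹)|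
  have hΛ : ∀ i j, 0 ≤ Λ i j := fun i j => by positivity
  refine ⟨(∑ i, ∑ j, Λ i j) + ∑ j, 2 * |αt j|, fun z hz => ?_⟩
  have hne : ∀ j, x j ≠ z := fun j h => hz ⟨j, h⟩
  obtain ⟨i, hi⟩ := Finite.exists_min fun j => dist (x j) z
  refine ⟨i, ?_⟩
  have hterm : ∀ j, -(4 * αt j * sphG (x j) z) ≤
      (if j = i then s * Real.log (2 * (dist (x i) z)⁻¹) else 0) + Λ i j + 2 * |αt j| := by
    intro j
    have hl := log_two_mul_inv_dist_nonneg (hne j)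
    rw [sphG_eq (hne j)]
    have h2 := le_abs_self (αt j)
    split_ifs with hji
    · subst hji
      nlinarith [mul_le_mul_of_nonneg_right (hs j) hl, hΛ j j]
    · have hd : 0 < dist (x j) z := dist_pos.2 (hne j)
      have hle : Real.log (2 * (dist (x j) z)⁻¹) ≤ |Real.log (4 * (dist (x i) (x j))⁻¹)| := by
        have he : x i ≠ x j := fun he => hji (hx he).symm
        refine le_trans (Real.log_le_log (by positivity) ?_) (le_abs_self _)
        have hd' : 0 < dist (x i) (x j) := dist_pos.2 he
        have htri := dist_triangle_right (x i) (x j) z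
        rw [← div_eq_mul_inv, ← div_eq_mul_inv, div_le_div_iff₀ hd hd']
        linarith [hi j]
      have := mul_le_mul_of_nonneg_left hle (by positivity : 0 ≤ 4 * |αt j|)
      have := neg_abs_le (αt j)
      simp only [Λ]
      nlinarith
  calc -potential αt x z = ∑ j, -(4 * αt j * sphG (x j) z) := by
        rw [potential, Finset.sum_neg_distrib]
    _ ≤ _ := Finset.sum_le_sum fun j _ => hterm j
    _ = s * Real.log (2 * (dist (x i) z)⁻¹) + ∑ j, Λ i j + ∑ j, 2 * |αt j| := by
        rw [Finset.sum_add_distrib, Finset.sum_add_distrib, Finset.sum_ite_eq' Finset.univ i]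
        simp
    _ ≤ _ := by
        have := Finset.single_le_sum (f := fun i => ∑ j, Λ i j)
          (fun i _ => Finset.sum_nonneg fun j _ => hΛ i j) (Finset.mem_univ i)
        linarith

/-- The external potential is dominated by a fraction of the entropy. -/
lemma exists_entropy_bound {k : ℕ} (hk : 0 < k) {x : Fin k → S2} (hx : Function.Injective x)
    {αt : Fin k → ℝ} (hα : ∀ j, -1 / 2 < αt j) :
    ∃ (C θ : ℝ) (E : S2 → ℝ), θ < 1 ∧ Integrable E areaMeasure ∧
      ∀ᵐ z ∂areaMeasure, ∀ r, 0 ≤ r →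
        -(potential αt x z * r) ≤ θ * (r * Real.log r) + E z + C * r := by
  have : Nonempty (Fin k) := ⟨⟨0, hk⟩⟩
  obtain ⟨j₀, hj₀⟩ := Finite.exists_max fun j => -(4 * αt j)
  set s₁ : ℝ := max 1 (-(4 * αt j₀))
  have hs1 : 1 ≤ s₁ := le_max_left _ _
  have hs2 : s₁ < 2 := max_lt (by norm_num) (by linarith [hα j₀])
  obtain ⟨C, hC⟩ := neg_potential_le hk hx αt (s := s₁) fun j => (hj₀ j).trans (le_max_right 1 _)
  set s : ℝ := (s₁ + 2) / 2 with hs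
  have hs0 : 0 < s := by linarith
  have hint := fun j => integrable_dist_rpow hs0 (by linarith : s < 2) (x j)
  set θ : ℝ := s₁ / s with hθ
  have hθ0 : 0 ≤ θ := by positivity
  refine ⟨C, θ, fun z => θ * 2 ^ s * ∑ j, dist (x j) z ^ (-s), (div_lt_one hs0).2 (by linarith),
    (integrable_finsetSum _ fun j _ => hint j).const_mul _, ?_⟩
  have hnull : ∀ᵐ z ∂areaMeasure, z ∉ Set.range x :=
    measure_eq_zero_iff_ae_notMem.1 ((Set.finite_range x).measure_zero _)
  filter_upwards [hnull] with z hz r hr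
  obtain ⟨i, hi⟩ := hC z hz
  have hd : 0 < dist (x i) z := dist_pos.2 fun h => hz ⟨i, h⟩
  have hY := mul_log_le hr (by positivity : 0 < (2 * (dist (x i) z)⁻¹) ^ s)
  rw [Real.log_rpow (by positivity)] at hY
  have hpow : (2 * (dist (x i) z)⁻¹) ^ s ≤ 2 ^ s * ∑ j, dist (x j) z ^ (-s) := by
    rw [Real.mul_rpow zero_le_two (by positivity), Real.inv_rpow hd.le, ← Real.rpow_neg hd.le]
    exact mul_le_mul_of_nonneg_left (Finset.single_le_sum
      (f := fun j => dist (x j) z ^ (-s)) (fun j _ => by positivity) (Finset.mem_univ i))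
      (by positivity)
  have hθs : θ * s = s₁ := div_mul_cancel₀ _ hs0.ne'
  have h1 := mul_le_mul_of_nonneg_right hi hr
  have h2 := mul_le_mul_of_nonneg_left (hY.trans (by linarith :
    _ ≤ r * Real.log r + 2 ^ s * ∑ j, dist (x j) z ^ (-s))) hθ0
  rw [← hθs] at h1
  linarith

/-! ### Existence and uniqueness of the minimizer -/

/-- Fatou's lemma for real-valued nonnegative integrable functions. -/
lemma integrable_and_integral_le_of_tendsto {α : Type*} [MeasurableSpace α] {μ : Measure α}
    {F : ℕ → α → ℝ} {f : α → ℝ} {c : ℕ → ℝ} {a : ℝ} (hF : ∀ n, Integrable (F n) μ)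
    (hF0 : ∀ n, 0 ≤ᵐ[μ] F n) (hlim : ∀ᵐ x ∂μ, Tendsto (fun n => F n x) atTop (nhds (f x)))
    (hc : ∀ n, ∫ x, F n x ∂μ ≤ c n) (hca : Tendsto c atTop (nhds a)) :
    Integrable f μ ∧ ∫ x, f x ∂μ ≤ a := by
  have hf0 : 0 ≤ᵐ[μ] f := by
    filter_upwards [hlim, ae_all_iff.2 hF0] with x hx hx0
    exact ge_of_tendsto' hx hx0
  have hfm : AEStronglyMeasurable f μ :=
    aestronglyMeasurable_of_tendsto_ae atTop (fun n => (hF n).1) hlim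
  have hle : ∫⁻ x, ENNReal.ofReal (f x) ∂μ ≤ ENNReal.ofReal a := by
    calc ∫⁻ x, ENNReal.ofReal (f x) ∂μ
        = ∫⁻ x, liminf (fun n => ENNReal.ofReal (F n x)) atTop ∂μ := by
          refine lintegral_congr_ae ?_
          filter_upwards [hlim] with x hx
          exact (ENNReal.tendsto_ofReal hx).liminf_eq.symm
      _ ≤ liminf (fun n => ∫⁻ x, ENNReal.ofReal (F n x) ∂μ) atTop :=
          lintegral_liminf_le' fun n => (hF n).1.aemeasurable.ennreal_ofReal
      _ ≤ liminf (fun n => ENNReal.ofReal (c n)) atTop := by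
          refine liminf_le_liminf (Eventually.of_forall fun n => ?_)
          rw [← ofReal_integral_eq_lintegral_ofReal (hF n) (hF0 n)]
          exact ENNReal.ofReal_le_ofReal (hc n)
      _ = ENNReal.ofReal a := (ENNReal.tendsto_ofReal hca).liminf_eq
  have ha : 0 ≤ a :=
    ge_of_tendsto' hca fun n => (integral_nonneg_of_ae (hF0 n)).trans (hc n)
  have hint : Integrable f μ :=
    ⟨hfm, (hasFiniteIntegral_iff_ofReal hf0).2 (hle.trans_lt ENNReal.ofReal_lt_top)⟩
  refine ⟨hint, ?_⟩
  rwa [← ofReal_integral_eq_lintegral_ofReal hint hf0, ENNReal.ofReal_le_ofReal_iff ha] at hle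

/-- A sequence of densities that is Cauchy in mean has a subsequence converging almost everywhere
to a density. -/
lemma exists_subseq_tendsto_ae {ρ : ℕ → S2 → ℝ} (hρ : ∀ n, memP' (ρ n))
    (hC : ∀ ε > 0, ∃ N, ∀ m ≥ N, ∀ n ≥ N, ∫ z, |ρ m z - ρ n z| ∂areaMeasure < ε) :
    ∃ (ns : ℕ → ℕ) (g : S2 → ℝ), StrictMono ns ∧ Measurable g ∧ (∀ z, 0 ≤ g z) ∧
      ∫ z, g z ∂areaMeasure = 1 ∧
      ∀ᵐ z ∂areaMeasure, Tendsto (fun i => ρ (ns i) z) atTop (nhds (g z)) := by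
  set F : ℕ → S2 →₁[areaMeasure] ℝ := fun n => (hρ n).integrable.toL1 (ρ n) with hFdef
  have hF : ∀ n, F n =ᵐ[areaMeasure] ρ n := fun n => (hρ n).integrable.coeFn_toL1
  have hcau : CauchySeq F := by
    refine Metric.cauchySeq_iff.2 fun ε hε => ?_
    obtain ⟨N, hN⟩ := hC ε hε
    refine ⟨N, fun m hm n hn => lt_of_eq_of_lt ?_ (hN m hm n hn)⟩
    rw [dist_eq_norm, hFdef, ← Integrable.toL1_sub, L1.norm_eq_integral_norm]
    refine integral_congr_ae ?_
    filter_upwards [((hρ m).integrable.sub (hρ n).integrable).coeFn_toL1] with z hz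
    rw [hz, Real.norm_eq_abs, Pi.sub_apply]
  obtain ⟨G, hG⟩ := cauchySeq_tendsto_of_complete hcau
  obtain ⟨ns, hns, hlim⟩ := (tendstoInMeasure_of_tendsto_Lp hG).exists_seq_tendsto_ae
  have hlim' : ∀ᵐ z ∂areaMeasure,
      0 ≤ G z ∧ Tendsto (fun i => ρ (ns i) z) atTop (nhds (G z)) := by
    filter_upwards [hlim, ae_all_iff.2 hF] with z hz hFz
    have h1 : Tendsto (fun i => ρ (ns i) z) atTop (nhds (G z)) :=
      hz.congr fun i => hFz (ns i)
    exact ⟨ge_of_tendsto' h1 fun i => (hρ _).2.1 z, h1⟩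
  refine ⟨ns, fun z => max (G z) 0, hns, (Lp.stronglyMeasurable G).measurable.max measurable_const,
    fun z => le_max_right _ _, ?_, ?_⟩
  · have h1 : ∫ z, max (G z) 0 ∂areaMeasure = ∫ z, G z ∂areaMeasure := by
      refine integral_congr_ae ?_
      filter_upwards [hlim'] with z hz
      exact max_eq_left hz.1
    have h2 := (continuous_integral (G := ℝ) (μ := areaMeasure)).continuousAt.tendsto.comp hG
    have h3 : ∀ n, ∫ z, F n z ∂areaMeasure = 1 := fun n => by
      rw [integral_congr_ae (hF n), (hρ n).2.2.1]
    rw [h1]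
    exact tendsto_nhds_unique (h2.congr h3) tendsto_const_nhds
  · filter_upwards [hlim'] with z hz
    rw [max_eq_left hz.1]
    exact hz.2

lemma memP'_const : memP' fun _ => (areaMeasure.real Set.univ)⁻¹ := by
  refine ⟨measurable_const, fun _ => by positivity, ?_, integrable_const _⟩
  rw [integral_const, smul_eq_mul, mul_inv_cancel₀]
  exact (measureReal_ne_zero_iff).2 areaMeasure_ne_zero

namespace memP'

variable {ρ : S2 → ℝ}

lemma integrable_potential_mul (h : memP' ρ) {k : ℕ} (αt : Fin k → ℝ) (x : Fin k → S2) :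
    Integrable (fun z => potential αt x z * ρ z) areaMeasure := by
  simp only [potential, Finset.sum_mul, mul_assoc]
  exact integrable_finsetSum _ fun j _ =>
    ((h.integrable_sphG_mul (x j)).const_mul _).const_mul _

lemma Lfun_eq (h : memP' ρ) {k : ℕ} (αt : Fin k → ℝ) (x : Fin k → S2) :
    Lfun k αt x ρ = ∫ z, potential αt x z * ρ z ∂areaMeasure := by
  simp only [potential, Finset.sum_mul, Lfun]
  rw [integral_finsetSum]
  · refine Finset.sum_congr rfl fun j _ => ?_
    rw [← integral_const_mul]
    simp only [mul_assoc]
  · intro j _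
    simp only [mul_assoc]
    exact ((h.integrable_sphG_mul (x j)).const_mul _).const_mul _

lemma integrable_mul_mul_sphG_add_half (h : memP' ρ) :
    Integrable (fun p : S2 × S2 => ρ p.1 * ρ p.2 * (sphG p.1 p.2 + 1 / 2))
      (areaMeasure.prod areaMeasure) := by
  simp only [mul_add]
  exact h.integrable_mul_mul_sphG.add ((h.integrable.mul_prod h.integrable).mul_const _)

lemma integral_mul_mul_sphG_add_half (h : memP' ρ) :
    ∫ p : S2 × S2, ρ p.1 * ρ p.2 * (sphG p.1 p.2 + 1 / 2) ∂(areaMeasure.prod areaMeasure) =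
      Rfun ρ + 1 / 2 := by
  simp only [mul_add]
  rw [integral_add h.integrable_mul_mul_sphG ((h.integrable.mul_prod h.integrable).mul_const _),
    integral_mul_const, integral_prod_mul ρ ρ, h.2.2.1, Rfun]
  norm_num

lemma mul_mul_sphG_add_half_nonneg (h : memP' ρ) (p : S2 × S2) :
    0 ≤ ρ p.1 * ρ p.2 * (sphG p.1 p.2 + 1 / 2) :=
  mul_nonneg (mul_nonneg (h.2.1 _) (h.2.1 _)) (by linarith [neg_half_le_sphG p.1 p.2])

lemma neg_half_le_Rfun (h : memP' ρ) : -(1 / 2) ≤ Rfun ρ := by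
  have : 0 ≤ ∫ p : S2 × S2, ρ p.1 * ρ p.2 * (sphG p.1 p.2 + 1 / 2)
      ∂(areaMeasure.prod areaMeasure) :=
    integral_nonneg fun p => h.mul_mul_sphG_add_half_nonneg p
  rw [h.integral_mul_mul_sphG_add_half] at this
  linarith

end memP'

/-- The functional `S` is bounded below and lower semicontinuous along sequences of densities
converging almost everywhere to a density; the limit has finite entropy. -/
lemma memP'_and_Sfun_le_of_tendsto {k : ℕ} (hk : 0 < k) {x : Fin k → S2}
    (hx : Function.Injective x) {αt : Fin k → ℝ} (hα : ∀ j, -1 / 2 < αt j) {β : ℝ} (hβ : 0 ≤ β) :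
    (∃ K : ℝ, ∀ ρ, memP' ρ → K ≤ Sfun k αt x β ρ) ∧
    ∀ (ρ : ℕ → S2 → ℝ) (g : S2 → ℝ) (a : ℝ), (∀ n, memP' (ρ n)) → Measurable g →
      (∀ z, 0 ≤ g z) → ∫ z, g z ∂areaMeasure = 1 →
      (∀ᵐ z ∂areaMeasure, Tendsto (fun n => ρ n z) atTop (nhds (g z))) →
      Tendsto (fun n => Sfun k αt x β (ρ n)) atTop (nhds a) →
      memP' g ∧ Sfun k αt x β g ≤ a := by
  obtain ⟨C, θ, E, hθ, hE, hbound⟩ := exists_entropy_bound hk hx hα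
  set J : (S2 → ℝ) → S2 → ℝ := fun ρ z =>
    ρ z * Real.log (ρ z) + potential αt x z * ρ z + (E z + C * ρ z + (1 - θ)) with hJ
  have hJle : ∀ ρ : S2 → ℝ, (∀ z, 0 ≤ ρ z) → ∀ᵐ z ∂areaMeasure,
      (1 - θ) * (ρ z * Real.log (ρ z) + 1) ≤ J ρ z := fun ρ hρ => by
    filter_upwards [hbound] with z hz
    have := hz (ρ z) (hρ z)
    simp only [hJ]
    linarith
  have hJ0 : ∀ ρ : S2 → ℝ, (∀ z, 0 ≤ ρ z) → 0 ≤ᵐ[areaMeasure] J ρ := fun ρ hρ => by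
    filter_upwards [hJle ρ hρ] with z hz
    have := sub_one_le_mul_log (hρ z)
    exact (mul_nonneg (by linarith) (by linarith [hρ z])).trans hz
  have hrest : ∀ {ρ}, memP' ρ → Integrable (fun z => E z + C * ρ z + (1 - θ)) areaMeasure :=
    fun h => (hE.add (h.integrable.const_mul C)).add (integrable_const _)
  have hJi : ∀ {ρ}, memP' ρ → Integrable (J ρ) areaMeasure := fun h =>
    (h.2.2.2.add (h.integrable_potential_mul αt x)).add (hrest h)
  set K : ℝ := ∫ z, E z ∂areaMeasure + C + (1 - θ) * areaMeasure.real Set.univ + β with hK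
  have hJint : ∀ {ρ}, memP' ρ →
      ∫ z, J ρ z ∂areaMeasure + 2 * β * (Rfun ρ + 1 / 2) = Sfun k αt x β ρ + K := by
    intro ρ h
    have e1 : ∫ z, (E z + C * ρ z + (1 - θ)) ∂areaMeasure =
        ∫ z, E z ∂areaMeasure + C + (1 - θ) * areaMeasure.real Set.univ := by
      have i1 : Integrable (fun z => E z + C * ρ z) areaMeasure :=
        hE.add (h.integrable.const_mul C)
      rw [integral_add i1 (integrable_const _),
        integral_add hE (h.integrable.const_mul C), integral_const_mul, h.2.2.1, integral_const,
        smul_eq_mul]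
      ring
    have e2 : ∫ z, J ρ z ∂areaMeasure = Hfun ρ + Lfun k αt x ρ +
        ∫ z, (E z + C * ρ z + (1 - θ)) ∂areaMeasure := by
      have i2 : Integrable (fun z => ρ z * Real.log (ρ z) + potential αt x z * ρ z) areaMeasure :=
        h.2.2.2.add (h.integrable_potential_mul αt x)
      rw [h.Lfun_eq, Hfun, ← integral_add h.2.2.2 (h.integrable_potential_mul αt x),
        ← integral_add i2 (hrest h)]
    rw [e2, e1, Sfun, hK]
    ring
  have hR : ∀ {ρ}, memP' ρ → 0 ≤ 2 * β * (Rfun ρ + 1 / 2) := fun h =>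
    mul_nonneg (by linarith) (by linarith [h.neg_half_le_Rfun])
  refine ⟨⟨-K, fun ρ h => ?_⟩, fun ρ g a hρ hg hg0 hg1 hlim hS => ?_⟩
  · linarith [hJint h, hR h, integral_nonneg_of_ae (hJ0 ρ h.2.1)]
  have hJlim : ∀ᵐ z ∂areaMeasure, Tendsto (fun n => J (ρ n) z) atTop (nhds (J g z)) := by
    filter_upwards [hlim] with z hz
    exact (((Real.continuous_mul_log.tendsto _).comp hz).add (hz.const_mul _)).add
      (((hz.const_mul C).const_add _).add_const _)
  have hSK := hS.add_const K
  obtain ⟨hJg, -⟩ := integrable_and_integral_le_of_tendsto (fun n => hJi (hρ n))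
    (fun n => hJ0 _ (hρ n).2.1) hJlim (fun n => by linarith [hJint (hρ n), hR (hρ n)]) hSK
  have hgP : memP' g := by
    refine ⟨hg, hg0, hg1, ?_⟩
    refine ((hJg.const_mul (1 - θ)⁻¹).add (integrable_const 1)).mono'
      (hg.mul (Real.measurable_log.comp hg)).aestronglyMeasurable ?_
    filter_upwards [hJle g hg0, hJ0 g hg0] with z hz hz0
    have h1 : g z * Real.log (g z) + 1 ≤ (1 - θ)⁻¹ * J g z := by
      rw [inv_mul_eq_div, le_div_iff₀ (by linarith), mul_comm]
      exact hz
    have h2 := sub_one_le_mul_log (hg0 z)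
    have h3 := hg0 z
    have h4 : 0 ≤ (1 - θ)⁻¹ * J g z := mul_nonneg (inv_nonneg.2 (by linarith)) hz0
    simp only [Real.norm_eq_abs, Pi.add_apply]
    rw [abs_le]
    constructor <;> linarith
  refine ⟨hgP, ?_⟩
  set T : (S2 → ℝ) → S2 × S2 → ℝ := fun ρ p =>
    J ρ p.1 * ρ p.2 + 2 * β * (ρ p.1 * ρ p.2 * (sphG p.1 p.2 + 1 / 2)) with hT
  have hTi : ∀ {ρ}, memP' ρ → Integrable (T ρ) (areaMeasure.prod areaMeasure) := fun h =>
    ((hJi h).mul_prod h.integrable).add (h.integrable_mul_mul_sphG_add_half.const_mul _)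
  have hTint : ∀ {ρ}, memP' ρ →
      ∫ p, T ρ p ∂(areaMeasure.prod areaMeasure) = Sfun k αt x β ρ + K := by
    intro ρ h
    rw [← hJint h, hT, integral_add ((hJi h).mul_prod h.integrable)
      (h.integrable_mul_mul_sphG_add_half.const_mul _), integral_prod_mul (J ρ) ρ, h.2.2.1,
      integral_const_mul, h.integral_mul_mul_sphG_add_half, mul_one]
  have hfst : ∀ {q : S2 → Prop}, (∀ᵐ z ∂areaMeasure, q z) →
      ∀ᵐ p ∂(areaMeasure.prod areaMeasure), q p.1 := fun h =>
    Measure.quasiMeasurePreserving_fst.ae h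
  have hsnd : ∀ {q : S2 → Prop}, (∀ᵐ z ∂areaMeasure, q z) →
      ∀ᵐ p ∂(areaMeasure.prod areaMeasure), q p.2 := fun h =>
    Measure.quasiMeasurePreserving_snd.ae h
  have hT0 : ∀ n, 0 ≤ᵐ[areaMeasure.prod areaMeasure] T (ρ n) := fun n => by
    filter_upwards [hfst (hJ0 _ (hρ n).2.1)] with p hp
    exact add_nonneg (mul_nonneg hp ((hρ n).2.1 _))
      (mul_nonneg (by linarith) ((hρ n).mul_mul_sphG_add_half_nonneg p))
  have hTlim : ∀ᵐ p ∂(areaMeasure.prod areaMeasure),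
      Tendsto (fun n => T (ρ n) p) atTop (nhds (T g p)) := by
    filter_upwards [hfst hJlim, hfst hlim, hsnd hlim] with p h1 h2 h3
    exact (h1.mul h3).add (((h2.mul h3).mul_const _).const_mul _)
  have := (integrable_and_integral_le_of_tendsto (fun n => hTi (hρ n)) hT0 hTlim
    (fun n => (hTint (hρ n)).le) hSK).2
  rw [hTint hgP] at this
  linarith

/-- (1) for every `ρ ∈ 𝒫'` the functionals `L(ρ)` and `R(ρ)` are finite (the
integrands are integrable); (2) `S = L + 2βR + H` attains its infimum over `𝒫'` at some `ρ̂ ∈ 𝒫'`;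
(3) any two minimizers agree almost everywhere with respect to the area measure. -/
theorem variational_problem_minimizer
    (k : ℕ) (hk : 3 ≤ k) (x : Fin k → S2) (hxinj : Function.Injective x)
    (αt : Fin k → ℝ) (hαt : ∀ j, -1/2 < αt j)
    (β : ℝ) (hβ : β = -1 - ∑ j, αt j) (hβpos : 0 < β) :
    (∀ ρ : S2 → ℝ, memP' ρ →
      (∀ j, Integrable (fun z => sphG (x j) z * ρ z) areaMeasure) ∧
      Integrable (fun p : S2 × S2 => ρ p.1 * ρ p.2 * sphG p.1 p.2)
        (areaMeasure.prod areaMeasure)) ∧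
    (∃ ρhat : S2 → ℝ, memP' ρhat ∧
      (∀ ρ : S2 → ℝ, memP' ρ → Sfun k αt x β ρhat ≤ Sfun k αt x β ρ)) ∧
    (∀ ρ₁ ρ₂ : S2 → ℝ, memP' ρ₁ → memP' ρ₂ →
      (∀ ρ : S2 → ℝ, memP' ρ → Sfun k αt x β ρ₁ ≤ Sfun k αt x β ρ) →
      (∀ ρ : S2 → ℝ, memP' ρ → Sfun k αt x β ρ₂ ≤ Sfun k αt x β ρ) →
      ρ₁ =ᵐ[areaMeasure] ρ₂) := by
  have hk0 : 0 < k := by omega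
  obtain ⟨⟨K, hK⟩, hlsc⟩ := memP'_and_Sfun_le_of_tendsto hk0 hxinj hαt hβpos.le
  refine ⟨fun ρ h => ⟨fun j => h.integrable_sphG_mul (x j), h.integrable_mul_mul_sphG⟩, ?_, ?_⟩
  · set V : Set ℝ := Sfun k αt x β '' {ρ | memP' ρ} with hV
    have hVb : BddBelow V := ⟨K, by rintro _ ⟨ρ, h, rfl⟩; exact hK ρ h⟩
    obtain ⟨u, -, hu, huV⟩ := exists_seq_tendsto_sInf (S := V) ⟨_, _, memP'_const, rfl⟩ hVb
    choose ρ hρ hρu using huV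
    have hinf : ∀ {ρ}, memP' ρ → sInf V ≤ Sfun k αt x β ρ := fun h => csInf_le hVb ⟨_, h, rfl⟩
    obtain ⟨ns, g, hns, hg, hg0, hg1, hlim⟩ := exists_subseq_tendsto_ae hρ fun ε hε => by
      set c : ℝ := ε / 6 with hc
      have hc0 : 0 < c := by positivity
      obtain ⟨N, hN⟩ := eventually_atTop.1
        (hu.eventually (gt_mem_nhds (lt_add_of_pos_right (sInf V) (pow_pos hc0 2))))
      refine ⟨N, fun m hm n hn => ?_⟩
      have h1 := (hρ m).mul_integral_abs_sub_le_Sfun (hρ n) αt x hβpos.le hc0.le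
      have h2 := hinf ((hρ m).midpoint (hρ n))
      rw [hρu, hρu] at h1
      have h3 : c * ∫ z, |ρ m z - ρ n z| ∂areaMeasure < c * ε := by
        have : ε = 6 * c := by rw [hc]; ring
        rw [this]
        nlinarith [hN m hm, hN n hn]
      exact lt_of_mul_lt_mul_left h3 hc0.le
    obtain ⟨hgP, hgS⟩ := hlsc (fun i => ρ (ns i)) g (sInf V) (fun i => hρ _) hg hg0 hg1 hlim
      ((hu.comp hns.tendsto_atTop).congr fun i => (hρu _).symm)
    exact ⟨g, hgP, fun ρ' h => hgS.trans (hinf h)⟩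
  · intro ρ₁ ρ₂ h₁ h₂ hmin₁ hmin₂
    have hint : Integrable (fun z => |ρ₁ z - ρ₂ z|) areaMeasure :=
      (h₁.integrable.sub h₂.integrable).abs
    have hnn : 0 ≤ ∫ z, |ρ₁ z - ρ₂ z| ∂areaMeasure := integral_nonneg fun _ => abs_nonneg _
    have hzero : ∫ z, |ρ₁ z - ρ₂ z| ∂areaMeasure = 0 := by
      refine le_antisymm (le_of_forall_pos_le_add fun ε hε => ?_) hnn
      have hc0 : 0 < ε / 4 := by positivity
      have h1 := h₁.mul_integral_abs_sub_le_Sfun h₂ αt x hβpos.le hc0.le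
      have h2 := hmin₁ _ (h₁.midpoint h₂)
      have h3 := hmin₂ _ (h₁.midpoint h₂)
      refine le_of_mul_le_mul_left ?_ hc0
      nlinarith
    rw [integral_eq_zero_iff_of_nonneg (fun _ => abs_nonneg _) hint] at hzero
    filter_upwards [hzero] with z hz
    exact sub_eq_zero.1 (abs_eq_zero.1 hz)
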